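/- arXiv:2407.09279 — 4 statements merged into one kernel-verified Lean document; each statement's English description precedes it below -/
import Mathlib

section
/- Let $H$ be a group and let $g$ be an automorphism of $H$ such that $g(t) = t$ for all $t \in Z(H)$ and $g(x)\cdot x^{-1} \in Z(H)$ for all $x \in H$. Then the assignment $h(x) \mapsto x^{-1}\cdot g(x)$ gives a well-defined function $f : H/Z(H) \to Z(H)$ (i.e., $x^{-1}g(x) = y^{-1}g(y)$ whenever $h(x) = h(y)$), this $f$ is a group homomorphism, and $g = g_f$. -/
/-- For a group homomorphism `f : H/Z(H) → Z(H)`, the map `g_f : H → H` given by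
`g_f(x) = x * f(h(x))`, where `h : H → H/Z(H)` is the canonical quotient map. -/
def gf {H : Type*} [Group H] (f : H ⧸ Subgroup.center H →* Subgroup.center H) (x : H) : H :=
  x * (f (QuotientGroup.mk x) : H)

/-- If `y * x⁻¹` is central, then so is `x⁻¹ * y`. -/
theorem inv_mul_mem_center_of_mul_inv_mem_center {H : Type*} [Group H] {x y : H}
    (h : y * x⁻¹ ∈ Subgroup.center H) : x⁻¹ * y ∈ Subgroup.center H := by
  have key : x⁻¹ * y = y * x⁻¹ := by
    have := Subgroup.mem_center_iff.mp h x⁻¹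
    calc x⁻¹ * y = x⁻¹ * (y * x⁻¹) * x := by group
      _ = y * x⁻¹ * x⁻¹ * x := by rw [this]
      _ = y * x⁻¹ := by group
  rwa [key]

/-- The homomorphism `x ↦ x⁻¹ * g x` into the center, for an endomorphism `g` that is the
identity modulo the center. -/
def centralDifference {H : Type*} [Group H] (g : H →* H)
    (hg : ∀ x : H, x⁻¹ * g x ∈ Subgroup.center H) : H →* Subgroup.center H :=
  MonoidHom.mk' (fun x => ⟨x⁻¹ * g x, hg x⟩) fun x y => Subtype.ext <| by
    have := Subgroup.mem_center_iff.mp (hg x) y⁻¹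
    calc (x * y)⁻¹ * g (x * y) = y⁻¹ * (x⁻¹ * g x) * g y := by
          rw [map_mul]; group
      _ = x⁻¹ * g x * (y⁻¹ * g y) := by rw [this]; group

/-- If `g` is an automorphism of `H` fixing `Z(H)` pointwise with
`g(x) * x⁻¹ ∈ Z(H)` for all `x`, then `h(x) ↦ x⁻¹ * g(x)` is a well-defined group
homomorphism `f : H/Z(H) → Z(H)` and `g = g_f`. -/
theorem exists_gf_of_central_aut {H : Type*} [Group H] (g : H ≃* H)
    (hg1 : ∀ t ∈ Subgroup.center H, g t = t)
    (hg2 : ∀ x : H, g x * x⁻¹ ∈ Subgroup.center H) :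
    (∀ x y : H, (QuotientGroup.mk x : H ⧸ Subgroup.center H) = QuotientGroup.mk y →
      x⁻¹ * g x = y⁻¹ * g y) ∧
    ∃ f : H ⧸ Subgroup.center H →* Subgroup.center H,
      (∀ x : H, (f (QuotientGroup.mk x) : H) = x⁻¹ * g x) ∧
      ∀ x : H, g x = gf f x := by
  have hg : ∀ x : H, x⁻¹ * (g : H →* H) x ∈ Subgroup.center H := fun x =>
    inv_mul_mem_center_of_mul_inv_mem_center (hg2 x)
  let f : H ⧸ Subgroup.center H →* Subgroup.center H :=
    QuotientGroup.lift (Subgroup.center H) (centralDifference (g : H →* H) hg) fun t ht =>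
      Subtype.ext (show t⁻¹ * g t = 1 by rw [hg1 t ht, inv_mul_cancel])
  have hf : ∀ x : H, (f (QuotientGroup.mk x) : H) = x⁻¹ * g x := fun _ => rfl
  refine ⟨fun x y hxy => ?_, f, hf, fun x => ?_⟩
  · rw [← hf, ← hf, hxy]
  · rw [gf, hf, mul_inv_cancel_left]
end

section
/- Let $H$ be a group, $h^*$ a section of $h : H \to H/Z(H)$, $\pi : H/Z(H) \to H/Z(H)$ a group homomorphism, $\sigma_1,\dots,\sigma_n$ automorphisms of $H$, and $s_1,\dots,s_n$ integers; let $\varphi$, $h'^*$, $\mathcal{A}$, $\mathcal{F}$ and $g_{\pi,f}$ be as in the setup. Then for every $f \in \mathcal{F}$, the map $g_{\pi,f}$ belongs to $\mathcal{A}$: it is a group homomorphism $H \to H$, it satisfies $g_{\pi,f}(t) = \varphi(t)$ for all $t \in Z(H)$, and $g_{\pi,f}(x)\cdot h'^*(h(x))^{-1} \in Z(H)$ for all $x \in H$. -/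
/-- `φ(t) = σ₁(t)^{s₁} ⋯ σₙ(t)^{sₙ}` (ordered product). -/
def phi {H : Type*} [Group H] {n : ℕ} (σ : Fin n → H ≃* H) (s : Fin n → ℤ) (t : H) : H :=
  (List.ofFn fun i => (σ i t) ^ (s i)).prod

/-- The "cocycle" `t'(a,b) = h*(a) * h*(b) * h*(ab)⁻¹` of a section `h*`. -/
def cocycle {H : Type*} [Group H] (hs : H ⧸ Subgroup.center H → H)
    (a b : H ⧸ Subgroup.center H) : H :=
  hs a * hs b * (hs (a * b))⁻¹

/-- `g_{π,f}(x) = φ(x * h*(h(x))⁻¹) * f(h(x)) * h'*(h(x))` where `h'* = h* ∘ π`. -/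
def gPi {H : Type*} [Group H] {n : ℕ} (hs : H ⧸ Subgroup.center H → H)
    (π : H ⧸ Subgroup.center H →* H ⧸ Subgroup.center H)
    (σ : Fin n → H ≃* H) (s : Fin n → ℤ)
    (f : H ⧸ Subgroup.center H → H) (x : H) : H :=
  phi σ s (x * (hs (QuotientGroup.mk x))⁻¹) * f (QuotientGroup.mk x) *
    hs (π (QuotientGroup.mk x))

theorem MulEquiv.apply_mem_center {H : Type*} [Group H] (e : H ≃* H) {t : H}
    (ht : t ∈ Subgroup.center H) : e t ∈ Subgroup.center H := by
  rw [Subgroup.mem_center_iff] at ht ⊢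
  intro g
  obtain ⟨g, rfl⟩ := e.surjective g
  rw [← map_mul, ht, map_mul]

theorem phi_succ {H : Type*} [Group H] {n : ℕ} (σ : Fin (n + 1) → H ≃* H)
    (s : Fin (n + 1) → ℤ) (t : H) :
    phi σ s t = σ 0 t ^ s 0 * phi (fun i => σ i.succ) (fun i => s i.succ) t := by
  simp [phi, List.ofFn_succ]

theorem phi_mem_center {H : Type*} [Group H] {n : ℕ} (σ : Fin n → H ≃* H) (s : Fin n → ℤ)
    {t : H} (ht : t ∈ Subgroup.center H) : phi σ s t ∈ Subgroup.center H := by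
  induction n with
  | zero => simp [phi, one_mem]
  | succ n ih =>
    rw [phi_succ]
    exact mul_mem (zpow_mem ((σ 0).apply_mem_center ht) _) (ih _ _)

theorem phi_mul {H : Type*} [Group H] {n : ℕ} (σ : Fin n → H ≃* H) (s : Fin n → ℤ)
    (t : H) {u : H} (hu : u ∈ Subgroup.center H) :
    phi σ s (t * u) = phi σ s t * phi σ s u := by
  induction n with
  | zero => simp [phi]
  | succ n ih =>
    have hc : Commute (σ 0 t) (σ 0 u) :=
      (Subgroup.mem_center_iff.mp ((σ 0).apply_mem_center hu) _)
    have hz := Subgroup.mem_center_iff.mp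
      (zpow_mem ((σ 0).apply_mem_center hu) (s 0))
    rw [phi_succ, phi_succ, phi_succ, ih, map_mul, hc.mul_zpow, mul_assoc, mul_assoc,
      ← mul_assoc (σ 0 u ^ s 0), ← hz, mul_assoc]

theorem mul_inv_section_mem_center {H : Type*} [Group H]
    {hs : H ⧸ Subgroup.center H → H}
    (hsec : ∀ a : H ⧸ Subgroup.center H, (QuotientGroup.mk (hs a) : H ⧸ Subgroup.center H) = a)
    {x : H} {a : H ⧸ Subgroup.center H} (hx : (QuotientGroup.mk x : H ⧸ Subgroup.center H) = a) :
    x * (hs a)⁻¹ ∈ Subgroup.center H := by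
  rw [← QuotientGroup.eq_one_iff, QuotientGroup.mk_mul, QuotientGroup.mk_inv, hsec, hx,
    mul_inv_cancel]

theorem cocycle_mem_center {H : Type*} [Group H]
    {hs : H ⧸ Subgroup.center H → H}
    (hsec : ∀ a : H ⧸ Subgroup.center H, (QuotientGroup.mk (hs a) : H ⧸ Subgroup.center H) = a)
    (a b : H ⧸ Subgroup.center H) : cocycle hs a b ∈ Subgroup.center H :=
  mul_inv_section_mem_center hsec (by rw [QuotientGroup.mk_mul, hsec, hsec])

/-- For every `f ∈ ℱ`, the map `g_{π,f}` belongs to `𝒜`: it is a group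
homomorphism, it agrees with `φ` on `Z(H)`, and `g_{π,f}(x) * h'*(h(x))⁻¹ ∈ Z(H)`
for all `x`. -/
theorem gPi_mem_A {H : Type*} [Group H] {n : ℕ}
    (hs : H ⧸ Subgroup.center H → H)
    (hsec : ∀ a : H ⧸ Subgroup.center H,
      (QuotientGroup.mk (hs a) : H ⧸ Subgroup.center H) = a)
    (π : H ⧸ Subgroup.center H →* H ⧸ Subgroup.center H)
    (σ : Fin n → H ≃* H) (s : Fin n → ℤ)
    (f : H ⧸ Subgroup.center H → H)
    (hfc : ∀ a, f a ∈ Subgroup.center H)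
    (hfF : ∀ a b, f a * f b =
      phi σ s (cocycle hs a b) * (cocycle (fun c => hs (π c)) a b)⁻¹ * f (a * b)) :
    (∀ x y : H, gPi hs π σ s f (x * y) = gPi hs π σ s f x * gPi hs π σ s f y) ∧
    (∀ t ∈ Subgroup.center H, gPi hs π σ s f t = phi σ s t) ∧
    (∀ x : H, gPi hs π σ s f x * (hs (π (QuotientGroup.mk x)))⁻¹ ∈ Subgroup.center H) := by
  refine ⟨fun x y => ?_, fun t ht => ?_, fun x => ?_⟩
  · have hu := mul_inv_section_mem_center hsec (x := x) rfl
    have hv := mul_inv_section_mem_center hsec (x := y) rfl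
    have hF := hfF (QuotientGroup.mk x) (QuotientGroup.mk y)
    have hfx := hfc (QuotientGroup.mk x)
    have hfxy := hfc (QuotientGroup.mk x * QuotientGroup.mk y)
    have hfy := hfc (QuotientGroup.mk y)
    unfold gPi
    rw [QuotientGroup.mk_mul]
    generalize (QuotientGroup.mk x : H ⧸ Subgroup.center H) = a at *
    generalize (QuotientGroup.mk y : H ⧸ Subgroup.center H) = b at *
    have ht := cocycle_mem_center hsec a b
    have hxy : x * y * (hs (a * b))⁻¹ =
        x * (hs a)⁻¹ * (y * (hs b)⁻¹) * cocycle hs a b := by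
      have h := Subgroup.mem_center_iff.mp hv (hs a)
      calc x * y * (hs (a * b))⁻¹
          = x * (hs a)⁻¹ * (hs a * (y * (hs b)⁻¹)) * hs b * (hs (a * b))⁻¹ := by group
        _ = _ := by rw [h, cocycle]; group
    have hpi : hs (π a) * hs (π b) = cocycle (fun c => hs (π c)) a b * hs (π (a * b)) := by
      simp [cocycle]
    have hfπ := Subgroup.mem_center_iff.mp hfxy (cocycle (fun c => hs (π c)) a b)
    have hφv := Subgroup.mem_center_iff.mp (phi_mem_center σ s hv)
    have hfb := Subgroup.mem_center_iff.mp hfy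
    rw [hxy, phi_mul σ s _ ht, phi_mul σ s _ hv]
    symm
    calc phi σ s (x * (hs a)⁻¹) * f a * hs (π a) * (phi σ s (y * (hs b)⁻¹) * f b * hs (π b))
        = phi σ s (x * (hs a)⁻¹) * ((f a * hs (π a)) * phi σ s (y * (hs b)⁻¹)) * f b *
            hs (π b) := by group
      _ = phi σ s (x * (hs a)⁻¹) * phi σ s (y * (hs b)⁻¹) * f a * (hs (π a) * f b) *
            hs (π b) := by rw [hφv]; group
      _ = phi σ s (x * (hs a)⁻¹) * phi σ s (y * (hs b)⁻¹) * (f a * f b) *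
            (hs (π a) * hs (π b)) := by rw [hfb]; group
      _ = phi σ s (x * (hs a)⁻¹) * phi σ s (y * (hs b)⁻¹) * phi σ s (cocycle hs a b) *
            (cocycle (fun c => hs (π c)) a b)⁻¹ *
            (f (a * b) * cocycle (fun c => hs (π c)) a b) * hs (π (a * b)) := by
          rw [hF, hpi]; simp only [mul_assoc]
      _ = _ := by rw [← hfπ]; simp only [mul_assoc, inv_mul_cancel_left]
  · have h1 : hs 1 ∈ Subgroup.center H := (QuotientGroup.eq_one_iff _).mp (hsec 1)
    have hF : f 1 = phi σ s (hs 1) * (hs 1)⁻¹ := by simpa [cocycle] using hfF 1 1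
    rw [gPi, (QuotientGroup.eq_one_iff t).mpr ht, map_one, hF, mul_assoc, inv_mul_cancel_right,
      ← phi_mul σ s _ h1, inv_mul_cancel_right]
  · rw [gPi, mul_inv_cancel_right]
    exact mul_mem (phi_mem_center σ s (mul_inv_section_mem_center hsec rfl)) (hfc _)
end

section
/- Let $H$ be a group, $h^*$ a section of $h : H \to H/Z(H)$, $\pi : H/Z(H) \to H/Z(H)$ a group homomorphism, $\sigma_1,\dots,\sigma_n$ automorphisms of $H$, and $s_1,\dots,s_n$ integers; let $\varphi$, $h'^*$ and $\mathcal{A}$ be as in the setup, and let $g \in \mathcal{A}$. Then for a group homomorphism $k : H \to H$ the following are equivalent: (i) $k \in \mathcal{A}$; (ii) there exists a group homomorphism $f : H \to H$ with image contained in $Z(H)$ and with $Z(H)$ contained in the kernel of $f$, such that $k(x) = g(x)\cdot f(x)$ for all $x \in H$. -/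
/-- If two homomorphisms differ pointwise by central elements, their quotient
`x ↦ (g x)⁻¹ * k x` is a homomorphism. -/
def MonoidHom.centralQuotient {G H : Type*} [Group G] [Group H] (g k : G →* H)
    (hc : ∀ x, (g x)⁻¹ * k x ∈ Subgroup.center H) : G →* H :=
  MonoidHom.mk' (fun x => (g x)⁻¹ * k x) fun x y => by
    have h := Subgroup.mem_center_iff.mp (hc x) (g y)⁻¹
    calc (g (x * y))⁻¹ * k (x * y) = (g y)⁻¹ * ((g x)⁻¹ * k x) * k y := by
          simp only [map_mul, mul_inv_rev, mul_assoc]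
      _ = (g x)⁻¹ * k x * ((g y)⁻¹ * k y) := by rw [h, mul_assoc]

/-- Two elements lying in the same right coset of a normal subgroup differ by an element of it. -/
theorem Subgroup.Normal.inv_mul_mem_of_mul_inv_mem {H : Type*} [Group H] {N : Subgroup H}
    (hN : N.Normal) {a b c : H} (ha : a * c⁻¹ ∈ N) (hb : b * c⁻¹ ∈ N) : a⁻¹ * b ∈ N := by
  have h := hN.conj_mem _ (N.mul_mem (N.inv_mem ha) hb) c⁻¹
  simpa [mul_assoc] using h

/-- Given `g ∈ 𝒜`, a group homomorphism `k : H → H` belongs to `𝒜` iff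
`k(x) = g(x) * f(x)` for some group homomorphism `f : H → H` with image contained
in `Z(H)` and with `Z(H)` contained in the kernel of `f`. -/
theorem mem_A_iff_mul_central {H : Type*} [Group H] {n : ℕ}
    (hs : H ⧸ Subgroup.center H → H)
    (hsec : ∀ a : H ⧸ Subgroup.center H,
      (QuotientGroup.mk (hs a) : H ⧸ Subgroup.center H) = a)
    (π : H ⧸ Subgroup.center H →* H ⧸ Subgroup.center H)
    (σ : Fin n → H ≃* H) (s : Fin n → ℤ)
    (g : H →* H)
    (hgA1 : ∀ t ∈ Subgroup.center H, g t = phi σ s t)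
    (hgA2 : ∀ x : H, g x * (hs (π (QuotientGroup.mk x)))⁻¹ ∈ Subgroup.center H)
    (k : H →* H) :
    ((∀ t ∈ Subgroup.center H, k t = phi σ s t) ∧
      (∀ x : H, k x * (hs (π (QuotientGroup.mk x)))⁻¹ ∈ Subgroup.center H)) ↔
    (∃ f : H →* H, (∀ x : H, f x ∈ Subgroup.center H) ∧
      (∀ t ∈ Subgroup.center H, f t = 1) ∧ ∀ x : H, k x = g x * f x) := by
  constructor
  · rintro ⟨hk1, hk2⟩
    have hc : ∀ x, (g x)⁻¹ * k x ∈ Subgroup.center H := fun x =>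
      Subgroup.Normal.inv_mul_mem_of_mul_inv_mem inferInstance (hgA2 x) (hk2 x)
    refine ⟨g.centralQuotient k hc, hc, fun t ht => ?_, fun x => (mul_inv_cancel_left _ _).symm⟩
    change (g t)⁻¹ * k t = 1
    rw [hgA1 t ht, hk1 t ht, inv_mul_cancel]
  · rintro ⟨f, hfc, hf1, hk⟩
    refine ⟨fun t ht => by rw [hk, hf1 t ht, mul_one, hgA1 t ht], fun x => ?_⟩
    rw [hk, mul_assoc, ← Subgroup.mem_center_iff.mp (hfc x), ← mul_assoc]
    exact mul_mem (hgA2 x) (hfc x)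
end

section
/- Let $H$ be a group and let $f_* : H/Z(H) \to \mathbb{Z}$ be a group homomorphism. For $x \in Z(H)$, define $f_x : H/Z(H) \to Z(H)$ by $f_x(a) = x^{f_*(a)}$. Then: (i) each $f_x$ is a group homomorphism, so $g_{f_x}$ is an automorphism of $H$; (ii) the map $\Phi : Z(H) \to \mathrm{Aut}(H)$ given by $\Phi(x) = g_{f_x}$ is a group homomorphism; and (iii) if $a_0 \in H/Z(H)$ satisfies $f_*(a_0) = n \ne 0$, then the kernel of $\Phi$ is contained in $\{x \in Z(H) : x^n = e\}$. -/
/-- For a homomorphism `f* : H/Z(H) → ℤ` and `x ∈ Z(H)`, the map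
`g_{f_x} : H → H`, `y ↦ y * f_x(h(y)) = y * x^{f*(h(y))}`. -/
def Gmap {H : Type*} [Group H] (fstar : H ⧸ Subgroup.center H →* Multiplicative ℤ)
    (x : H) (y : H) : H :=
  y * x ^ (Multiplicative.toAdd (fstar (QuotientGroup.mk y)))

/-- Multiplying `y` by a power of a central element does not change its class in `H/Z(H)`. -/
theorem QuotientGroup.mk_mul_zpow_of_mem_center {H : Type*} [Group H] {x : H}
    (hx : x ∈ Subgroup.center H) (y : H) (k : ℤ) :
    (QuotientGroup.mk (y * x ^ k) : H ⧸ Subgroup.center H) = QuotientGroup.mk y :=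
  QuotientGroup.mk_mul_of_mem y (Subgroup.zpow_mem _ hx k)

theorem Gmap_mul_left {H : Type*} [Group H]
    (fstar : H ⧸ Subgroup.center H →* Multiplicative ℤ) {x₁ x₂ : H}
    (h₁ : x₁ ∈ Subgroup.center H) (h₂ : x₂ ∈ Subgroup.center H) (y : H) :
    Gmap fstar (x₁ * x₂) y = Gmap fstar x₁ (Gmap fstar x₂ y) := by
  have hc : Commute x₁ x₂ := (Subgroup.mem_center_iff.mp h₁ x₂).symm
  unfold Gmap
  rw [QuotientGroup.mk_mul_zpow_of_mem_center h₂, hc.mul_zpow, (hc.zpow_zpow _ _).eq, mul_assoc]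

theorem Gmap_one_left {H : Type*} [Group H]
    (fstar : H ⧸ Subgroup.center H →* Multiplicative ℤ) (y : H) : Gmap fstar 1 y = y := by
  simp [Gmap]

theorem Gmap_mul_right {H : Type*} [Group H]
    (fstar : H ⧸ Subgroup.center H →* Multiplicative ℤ) {x : H}
    (hx : x ∈ Subgroup.center H) (y z : H) :
    Gmap fstar x (y * z) = Gmap fstar x y * Gmap fstar x z := by
  have hc (k : ℤ) : z * x ^ k = x ^ k * z :=
    Subgroup.mem_center_iff.mp (Subgroup.zpow_mem _ hx k) z
  unfold Gmap
  rw [QuotientGroup.mk_mul, map_mul, toAdd_mul, zpow_add, mul_assoc y, ← mul_assoc z, hc]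
  simp only [mul_assoc]

theorem Gmap_bijective {H : Type*} [Group H]
    (fstar : H ⧸ Subgroup.center H →* Multiplicative ℤ) {x : H}
    (hx : x ∈ Subgroup.center H) : Function.Bijective (Gmap fstar x) := by
  have hx' := inv_mem hx
  refine Function.bijective_iff_has_inverse.mpr ⟨Gmap fstar x⁻¹, fun y => ?_, fun y => ?_⟩
  · rw [← Gmap_mul_left fstar hx' hx, inv_mul_cancel, Gmap_one_left]
  · rw [← Gmap_mul_left fstar hx hx', mul_inv_cancel, Gmap_one_left]

/-- (i) each `f_x : a ↦ x^{f*(a)}` is a group homomorphism, and `g_{f_x}` is an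
automorphism of `H`; (ii) `Φ : Z(H) → Aut(H)`, `x ↦ g_{f_x}`, is a group
homomorphism; (iii) if `f*(a₀) = n ≠ 0`, then the kernel of `Φ` is contained in
`{x ∈ Z(H) : xⁿ = e}`. -/
theorem Gmap_hom_aut_ker {H : Type*} [Group H]
    (fstar : H ⧸ Subgroup.center H →* Multiplicative ℤ) :
    (∀ x ∈ Subgroup.center H,
      (∀ a b : H ⧸ Subgroup.center H,
        x ^ (Multiplicative.toAdd (fstar (a * b)))
          = x ^ (Multiplicative.toAdd (fstar a)) * x ^ (Multiplicative.toAdd (fstar b))) ∧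
      (∀ y z : H, Gmap fstar x (y * z) = Gmap fstar x y * Gmap fstar x z) ∧
      Function.Bijective (Gmap fstar x)) ∧
    (∀ x₁ ∈ Subgroup.center H, ∀ x₂ ∈ Subgroup.center H,
      ∀ y : H, Gmap fstar (x₁ * x₂) y = Gmap fstar x₁ (Gmap fstar x₂ y)) ∧
    (∀ (a₀ : H ⧸ Subgroup.center H) (m : ℤ), Multiplicative.toAdd (fstar a₀) = m → m ≠ 0 →
      ∀ x ∈ Subgroup.center H, (∀ y : H, Gmap fstar x y = y) → x ^ m = 1) := by
  refine ⟨fun x hx => ⟨fun a b => by rw [map_mul, toAdd_mul, zpow_add],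
    Gmap_mul_right fstar hx, Gmap_bijective fstar hx⟩,
    fun x₁ h₁ x₂ h₂ y => Gmap_mul_left fstar h₁ h₂ y, ?_⟩
  rintro a₀ m rfl - x - hfix
  obtain ⟨y, rfl⟩ := QuotientGroup.mk_surjective a₀
  exact mul_eq_left.mp (hfix y)
end
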